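/- arXiv:2110.01376 — 2 statements merged into one kernel-verified Lean document; each statement's English description precedes it below -/
import Mathlib

section
/- Let A be an n-by-n matrix with complex entries, and suppose A has eigenvalues λ, λ₂, …, λₙ (listed with multiplicities, so that the characteristic polynomial of A equals (X − λ)(X − λ₂)⋯(X − λₙ)). If x ∈ ℂⁿ is an eigenvector of A associated with the eigenvalue λ, and y ∈ ℂⁿ is arbitrary, then the matrix A + x yᵀ̄ (the rank-one update of A by the outer product of x with the conjugate transpose of y) has eigenvalues λ + y*x, λ₂, …, λₙ (with multiplicities); equivalently, the characteristic polynomial of A + x y* equals (X − (λ + y*x))(X − λ₂)⋯(X − λₙ). -/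
open Polynomial Matrix

/-- **Brauer's theorem.** If the complex `n × n` matrix `A` has eigenvalues
`λ, λ₂, …, λₙ` (with multiplicities, i.e. its characteristic polynomial is
`(X − λ)(X − λ₂)⋯(X − λₙ)`), `x` is an eigenvector of `A` for `λ`, and `y ∈ ℂⁿ`,
then `A + x y*` has eigenvalues `λ + y*x, λ₂, …, λₙ`. -/
theorem brauer (n : ℕ) (hn : 0 < n) (A : Matrix (Fin n) (Fin n) ℂ)
    (lam : ℂ) (l : Fin (n - 1) → ℂ)
    (hchar : A.charpoly = (X - C lam) * ∏ i : Fin (n - 1), (X - C (l i)))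
    (x y : Fin n → ℂ) (hx : x ≠ 0) (hAx : A.mulVec x = lam • x) :
    (A + vecMulVec x (star y)).charpoly
      = (X - C (lam + star y ⬝ᵥ x)) * ∏ i : Fin (n - 1), (X - C (l i)) := by
  classical
  set u : Fin n → ℂ[X] := fun i => C (x i) with hu
  set v : Fin n → ℂ[X] := fun i => C (star y i) with hv
  set p : ℂ[X] := X - C lam with hp
  have hp0 : p ≠ 0 := X_sub_C_ne_zero lam
  have hMu : A.charmatrix *ᵥ u = p • u := by
    have h1 : (A.map C) *ᵥ u = C lam • u := by
      funext i
      have h := congrArg C (congrFun hAx i)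
      simpa [Matrix.mulVec, dotProduct, hu] using h
    rw [charmatrix, Matrix.sub_mulVec]
    change _ - (A.map C) *ᵥ u = _
    rw [h1, hp, sub_smul]
    congr 1
    funext i
    simp [Matrix.scalar_apply, Matrix.mulVec_diagonal]
  have hB : (A + vecMulVec x (star y)).charmatrix = A.charmatrix - vecMulVec u v := by
    ext1 i j
    simp only [charmatrix_apply, Matrix.sub_apply, Matrix.add_apply, vecMulVec_apply, hu, hv,
      map_add, map_mul]
    ring
  have hmul : A.charmatrix * (scalar (Fin n) p - vecMulVec u v)
      = p • (A.charmatrix - vecMulVec u v) := by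
    rw [Matrix.mul_sub, Matrix.mul_vecMulVec, hMu, smul_sub, Matrix.smul_vecMulVec]
    congr 1
    ext1 i j
    simp [Matrix.scalar_apply, mul_comm]
  have hdet : (scalar (Fin n) p - vecMulVec u v).det = p ^ (n - 1) * (p - v ⬝ᵥ u) := by
    rw [← Matrix.eval_charpoly, charpoly_vecMulVec]
    obtain ⟨m, rfl⟩ : ∃ m, n = m + 1 := ⟨n - 1, by omega⟩
    simp [pow_succ, dotProduct_comm u v]
    ring
  have hvu : p - v ⬝ᵥ u = X - C (lam + star y ⬝ᵥ x) := by
    simp [dotProduct, hu, hv, hp, sub_sub]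
  have key := congrArg Matrix.det hmul
  rw [det_mul, hdet, det_smul, ← hB, hvu, Fintype.card_fin] at key
  change A.charpoly * _ = _ * (A + vecMulVec x (star y)).charpoly at key
  rw [hchar] at key
  apply mul_left_cancel₀ (pow_ne_zero n hp0)
  rw [← key]
  obtain ⟨m, rfl⟩ : ∃ m, n = m + 1 := ⟨n - 1, by omega⟩
  simp only [Nat.add_sub_cancel, pow_succ]
  ring
end

section
/- Let A be an n-by-n complex matrix (n ≥ 1), let x ∈ ℂⁿ be an eigenvector of A associated with an eigenvalue λ, and let y ∈ ℂⁿ. If Q is any invertible n-by-n complex matrix whose first column is x, then the matrix Q⁻¹ (A + x y*) Q agrees with Q⁻¹ A Q in all entries except in the first row; in particular, its first column is (λ + y*x) e₁ (where e₁ is the first standard basis vector) and the entries below the (1,1) position in the first column are zero, while all entries in rows 2 through n of Q⁻¹ (A + x y*) Q coincide with the corresponding entries of Q⁻¹ A Q. -/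
open Matrix

/-- If `x` is an eigenvector of `A` for `λ`, `y ∈ ℂⁿ`, and `Q` is any invertible
matrix whose first column is `x`, then `Q⁻¹ (A + x y*) Q` agrees with `Q⁻¹ A Q`
in all rows except the first; its first column is `(λ + y*x) e₁`. -/
theorem conjugated_rank_one_update (n : ℕ) (hn : 0 < n)
    (A Q : Matrix (Fin n) (Fin n) ℂ) (lam : ℂ) (x y : Fin n → ℂ)
    (hx : x ≠ 0) (hAx : A.mulVec x = lam • x)
    (hQ : IsUnit Q.det) (hQcol : ∀ i, Q i ⟨0, hn⟩ = x i) :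
    (∀ i, (Q⁻¹ * (A + vecMulVec x (star y)) * Q) i ⟨0, hn⟩
        = if i = ⟨0, hn⟩ then lam + star y ⬝ᵥ x else 0) ∧
    (∀ i j, i ≠ ⟨0, hn⟩ →
        (Q⁻¹ * (A + vecMulVec x (star y)) * Q) i j = (Q⁻¹ * A * Q) i j) := by
  have hQx : Q *ᵥ Pi.single ⟨0, hn⟩ 1 = x := by
    ext i
    simp [hQcol]
  have hinv : Q⁻¹ *ᵥ x = Pi.single ⟨0, hn⟩ 1 := by
    rw [← hQx, mulVec_mulVec, nonsing_inv_mul Q hQ, one_mulVec]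
  constructor
  · intro i
    have h : (Q⁻¹ * (A + vecMulVec x (star y)) * Q) *ᵥ Pi.single ⟨0, hn⟩ 1
        = (lam + star y ⬝ᵥ x) • Pi.single ⟨0, hn⟩ (1 : ℂ) := by
      rw [← mulVec_mulVec, hQx, ← mulVec_mulVec, add_mulVec, hAx, vecMulVec_mulVec,
        op_smul_eq_smul, ← add_smul, mulVec_smul, hinv]
    have h2 := congrFun h i
    rw [mulVec_single_one] at h2
    simpa [Pi.single_apply] using h2
  · intro i j hij
    rw [mul_add, add_mul, mul_vecMulVec, hinv, vecMulVec_mul, Matrix.add_apply, vecMulVec_apply]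
    simp [hij]
end
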